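/- Let α ∈ ℂ with 0 < Re α ≤ 1/2, let k satisfy 1 − Re α < k < 1, set λ = sin(πα)/π, and let g ∈ E_k. Then f ∈ E_k satisfies the Stieltjes equation f(x) = g(x) + λ ∫₀^∞ f(y)/(x+y) dy for almost every x > 0 if and only if f(x) = g(x) + λ ∫₀^∞ R₂(x,y;α)·g(y) dy for almost every x > 0, where the latter integral is absolutely convergent. -/

import Mathlib

open MeasureTheory Set Asymptotics

noncomputable section

/-- `r₁(x;α)` from Dixon's resolvent kernels. -/
def r1 (α : ℂ) (x : ℝ) : ℂ :=
  if α = -(1/2 : ℂ) then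
    -(2 / (Real.pi : ℂ)) * ((x : ℂ) ^ ((1 : ℂ)/2) * (Real.log x : ℂ)) / (1 - (x : ℂ) ^ 2)
  else
    (1 / Complex.cos ((Real.pi : ℂ) * α)) *
      (((x : ℂ) ^ (-α) - (x : ℂ) ^ (α + 1)) / (1 - (x : ℂ) ^ 2))

def r2 (α : ℂ) (x : ℝ) : ℂ := -(1 / (x : ℂ)) * r1 (-α) x

def r3 (α : ℂ) (x : ℝ) : ℂ := (x : ℂ) ^ 2 * r2 α x

def R1 (α : ℂ) (x y : ℝ) : ℂ := (1 / (y : ℂ)) * r1 α (x / y)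
def R2 (α : ℂ) (x y : ℝ) : ℂ := (1 / (y : ℂ)) * r2 α (x / y)
def R3 (α : ℂ) (x y : ℝ) : ℂ := (1 / (y : ℂ)) * r3 α (x / y)

/-- membership in `E`: integrable on `(0,∞)` with weight `1/(1+x)`. -/
def MemE (f : ℝ → ℂ) : Prop :=
  IntegrableOn (fun x : ℝ => f x / (1 + (x : ℂ))) (Ioi 0)

/-- membership in `E_k`: integrable on `(0,∞)` with weight `x^{k-1}`. -/
def MemEk (k : ℝ) (f : ℝ → ℂ) : Prop :=
  IntegrableOn (fun x : ℝ => (x ^ (k - 1) : ℝ) • f x) (Ioi 0)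

/-- membership in `B_{ε,η}`. -/
def MemB (ε η : ℝ) (f : ℝ → ℂ) : Prop :=
  ContinuousOn f (Ioi 0) ∧
  ∃ M : ℝ, (∀ x : ℝ, 1 < x → x ^ ε * ‖f x‖ ≤ M) ∧ (∀ x : ℝ, 0 < x → x < 1 → x ^ η * ‖f x‖ ≤ M)

/-- the norm of `B_{ε,η}`. -/
def Bnorm (ε η : ℝ) (f : ℝ → ℂ) : ℝ :=
  sSup ((fun x : ℝ => x ^ ε * ‖f x‖) '' Ioi 1) + sSup ((fun x : ℝ => x ^ η * ‖f x‖) '' Ioo 0 1)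

/-- admissible weight pair `(φ₁,φ₂)`. -/
def AdmissiblePair (φ₁ φ₂ : ℝ → ℝ) : Prop :=
  ContinuousOn φ₁ (Ioi 0) ∧ ContinuousOn φ₂ (Ioi 0) ∧
  (∀ y : ℝ, 0 < y → (φ₁ y ∈ Ioo (0:ℝ) 1 ∧ φ₂ y ∈ Ioo (0:ℝ) 1 ∧ φ₁ y + φ₂ y = 1)) ∧
  φ₁ =O[Filter.atTop] (fun y : ℝ => 1 / y) ∧
  (fun y : ℝ => φ₁ y - 1) =O[nhdsWithin 0 (Ioi 0)] (fun y : ℝ => y)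

/-- the combined kernel `R₂₃`. -/
def R23 (φ₁ φ₂ : ℝ → ℝ) (α : ℂ) (x y : ℝ) : ℂ :=
  (φ₁ y : ℂ) * R2 α x y + (φ₂ y : ℂ) * R3 α x y

open Filter Topology

lemma abs_log_div_le {t δ : ℝ} (ht : 0 < t) (hδ0 : 0 < δ) (hδ2 : δ < 2) :
    |Real.log t| / |1 - t ^ 2| ≤ (1 / δ + 1 / (2 - δ)) * t ^ (-δ) := by
  have hpos : 0 < t ^ (-δ) := Real.rpow_pos_of_pos ht _
  have h2δ : 0 < 2 - δ := by linarith
  have key : t ^ (2 - δ) = t ^ (-δ) * t ^ 2 := by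
    rw [← Real.rpow_natCast t 2, ← Real.rpow_add ht]; congr 1; push_cast; ring
  have hinv : t ^ δ * t ^ (-δ) = 1 := by
    rw [← Real.rpow_add ht]; simp
  rcases lt_trichotomy t 1 with h | h | h
  · have h1 : Real.log t ≤ 0 := Real.log_nonpos ht.le h.le
    have h2 : 0 < 1 - t ^ 2 := by nlinarith
    rw [abs_of_nonpos h1, abs_of_pos h2, div_le_iff₀ h2]
    have h3 : δ * -Real.log t ≤ t ^ (-δ) - 1 := by
      have := Real.log_le_sub_one_of_pos hpos
      rw [Real.log_rpow ht] at this
      linarith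
    have h4 : t ^ (2 - δ) ≤ 1 := Real.rpow_le_one ht.le h.le h2δ.le
    have h5 : -Real.log t ≤ 1 / δ * (t ^ (-δ) * (1 - t ^ 2)) := by
      rw [one_div, inv_mul_eq_div, le_div_iff₀ hδ0]
      nlinarith
    have h6 : 0 ≤ 1 / (2 - δ) * (t ^ (-δ) * (1 - t ^ 2)) := by positivity
    linarith
  · subst h; simp; positivity
  · have h1 : 0 ≤ Real.log t := Real.log_nonneg h.le
    have h2 : 0 < -(1 - t ^ 2) := by nlinarith
    rw [abs_of_nonneg h1, abs_of_neg (by linarith), div_le_iff₀ h2]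
    have h3 : (2 - δ) * Real.log t ≤ t ^ (2 - δ) - 1 := by
      have := Real.log_le_sub_one_of_pos (Real.rpow_pos_of_pos ht (2 - δ))
      rwa [Real.log_rpow ht] at this
    have h4 : t ^ (-δ) ≤ 1 := Real.rpow_le_one_of_one_le_of_nonpos h.le (by linarith)
    have h5 : Real.log t ≤ 1 / (2 - δ) * (t ^ (-δ) * -(1 - t ^ 2)) := by
      rw [one_div, inv_mul_eq_div, le_div_iff₀ h2δ]
      nlinarith
    have h6 : 0 ≤ 1 / δ * (t ^ (-δ) * -(1 - t ^ 2)) := by positivity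
    linarith

lemma norm_ofReal_cpow_sub_le {t : ℝ} (ht : 0 < t) (p q : ℂ) :
    ‖(t : ℂ) ^ p - (t : ℂ) ^ q‖ ≤ |Real.log t| * (t ^ p.re + t ^ q.re) * ‖p - q‖ := by
  have hne : (t : ℂ) ≠ 0 := by exact_mod_cast ht.ne'
  refine (convex_segment q p).norm_image_sub_le_of_norm_hasDerivWithin_le (𝕜 := ℂ)
    (f := fun z : ℂ => (t : ℂ) ^ z) (f' := fun z => (t : ℂ) ^ z * Complex.log t) (fun z _ => ?_)
    (fun z hz => ?_) (left_mem_segment ℝ q p) (right_mem_segment ℝ q p)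
  · simpa using ((hasDerivAt_id z).const_cpow (Or.inl hne)).hasDerivWithinAt
  · have hre : z.re ∈ segment ℝ q.re p.re := by
      obtain ⟨a, b, ha, hb, hab, rfl⟩ := hz
      exact ⟨a, b, ha, hb, hab, by simp⟩
    rw [segment_eq_uIcc, mem_uIcc] at hre
    rw [norm_mul, Complex.norm_cpow_eq_rpow_re_of_pos ht, ← Complex.ofReal_log ht.le,
      Complex.norm_real, Real.norm_eq_abs, mul_comm]
    have hp := Real.rpow_pos_of_pos ht p.re
    have hq := Real.rpow_pos_of_pos ht q.re
    refine mul_le_mul_of_nonneg_left ?_ (abs_nonneg _)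
    rcases le_total t 1 with h | h
    · rcases hre with ⟨h1, _⟩ | ⟨h1, _⟩
      · linarith [Real.rpow_le_rpow_of_exponent_ge ht h h1]
      · linarith [Real.rpow_le_rpow_of_exponent_ge ht h h1]
    · rcases hre with ⟨_, h1⟩ | ⟨_, h1⟩
      · linarith [Real.rpow_le_rpow_of_exponent_le h h1]
      · linarith [Real.rpow_le_rpow_of_exponent_le h h1]

lemma integrableOn_Ioi_of_norm_le_rpow {E : Type*} [NormedAddCommGroup E] {F : ℝ → E}
    {A B p q : ℝ} (hF : StronglyMeasurable F)
    (hp : p < 1) (hq : 1 < q) (hA : ∀ t, 0 < t → ‖F t‖ ≤ A * t ^ (-p))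
    (hB : ∀ t, 0 < t → ‖F t‖ ≤ B * t ^ (-q)) : IntegrableOn F (Ioi 0) := by
  rw [← Ioc_union_Ioi_eq_Ioi zero_le_one]
  refine IntegrableOn.union ?_ ?_
  · have h := (intervalIntegral.intervalIntegrable_rpow' (a := 0) (b := 1) (r := -p)
      (by linarith)).1.const_mul A
    refine Integrable.mono' h hF.aestronglyMeasurable ?_
    filter_upwards [ae_restrict_mem measurableSet_Ioc] with t ht using hA t ht.1
  · have h := (integrableOn_Ioi_rpow_of_lt (a := -q) (by linarith) zero_lt_one).const_mul B
    refine Integrable.mono' h hF.aestronglyMeasurable ?_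
    filter_upwards [ae_restrict_mem measurableSet_Ioi] with t ht using hB t (zero_lt_one.trans ht)

/-- The numerator `u ^ (a - 1) - u ^ (-a)` of the resolvent kernel. -/
def cpowGap (a : ℂ) (u : ℝ) : ℂ := (u : ℂ) ^ (a - 1) - (u : ℂ) ^ (-a)

lemma measurable_ofReal_cpow (a : ℂ) : Measurable fun u : ℝ => (u : ℂ) ^ a :=
  Complex.measurable_ofReal.pow_const a

lemma measurable_cpowGap (a : ℂ) : Measurable (cpowGap a) :=
  (measurable_ofReal_cpow _).sub (measurable_ofReal_cpow _)

lemma rpow_mul_abs_log_div_le {t s k : ℝ} (ht : 0 < t) (h0 : 0 < k + s) (h2 : k + s < 2) :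
    t ^ s * (|Real.log t| / |1 - t ^ 2|) ≤ (1 / (k + s) + 1 / (2 - (k + s))) * t ^ (-k) := by
  calc _ ≤ t ^ s * ((1 / (k + s) + 1 / (2 - (k + s))) * t ^ (-(k + s))) :=
        mul_le_mul_of_nonneg_left (abs_log_div_le ht h0 h2) (by positivity)
    _ = (1 / (k + s) + 1 / (2 - (k + s))) * (t ^ s * t ^ (-(k + s))) := by ring
    _ = _ := by rw [← Real.rpow_add ht]; congr 2; ring

/-- The constant bounding the quotient `(u ^ (a - 1) + u ^ (-a)) * log u / (1 - u ^ 2)`. -/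
def logGapConst (σ k : ℝ) : ℝ :=
  (1 / (k + (σ - 1)) + 1 / (2 - (k + (σ - 1)))) + (1 / (k + -σ) + 1 / (2 - (k + -σ)))

lemma log_gap_le {t σ k : ℝ} (ht : 0 < t) (h1 : 1 - σ < k) (h2 : σ < k) (h3 : k < 3 - σ)
    (h4 : k < 2 + σ) : (t ^ (σ - 1) + t ^ (-σ)) * (|Real.log t| / |1 - t ^ 2|) ≤
      logGapConst σ k * t ^ (-k) := by
  rw [add_mul, logGapConst, add_mul]
  exact add_le_add (rpow_mul_abs_log_div_le ht (by linarith) (by linarith))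
    (rpow_mul_abs_log_div_le ht (by linarith) (by linarith))

lemma norm_cpowGap_div_le_log {t : ℝ} (ht : 0 < t) (a : ℂ) :
    ‖cpowGap a t / (1 - (t : ℂ) ^ 2)‖ ≤
      ‖2 * a - 1‖ * ((t ^ (a.re - 1) + t ^ (-a.re)) * (|Real.log t| / |1 - t ^ 2|)) := by
  have hn : ‖1 - (t : ℂ) ^ 2‖ = |1 - t ^ 2| := by
    rw [← Real.norm_eq_abs, ← Complex.norm_real]; push_cast; rfl
  have h := norm_ofReal_cpow_sub_le ht (a - 1) (-a)
  rw [norm_div, hn, cpowGap]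
  calc _ ≤ (|Real.log t| * (t ^ (a - 1).re + t ^ (-a).re) * ‖a - 1 - -a‖) / |1 - t ^ 2| := by gcongr
    _ = _ := by
        rw [show a - 1 - -a = 2 * a - 1 by ring]; simp only [Complex.sub_re, Complex.neg_re,
          Complex.one_re]; ring

lemma norm_cpowGap_div_le {t k : ℝ} {a : ℂ} (ht : 0 < t) (h1 : 1 - a.re < k) (h2 : a.re < k)
    (h3 : k < 3 - a.re) (h4 : k < 2 + a.re) :
    ‖cpowGap a t / (1 - (t : ℂ) ^ 2)‖ ≤ ‖2 * a - 1‖ * logGapConst a.re k * t ^ (-k) := by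
  refine (norm_cpowGap_div_le_log ht a).trans ?_
  rw [mul_assoc]
  exact mul_le_mul_of_nonneg_left (log_gap_le ht h1 h2 h3 h4) (norm_nonneg _)

lemma integral_cpow_div_one_add {a : ℂ} (h0 : 0 < a.re) (h1 : a.re < 1) :
    ∫ u in Ioi (0 : ℝ), (u : ℂ) ^ (a - 1) / (1 + (u : ℂ)) =
      Real.pi / Complex.sin (Real.pi * a) := by
  have hbeta : Complex.betaIntegral a (1 - a) = Real.pi / Complex.sin (Real.pi * a) := by
    rw [← Complex.Gamma_mul_Gamma_one_sub,
      Complex.Gamma_mul_Gamma_eq_betaIntegral h0 (by simpa using h1)]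
    simp
  have himg : (fun u : ℝ => u / (1 + u)) '' Ioi 0 = Ioo 0 1 := by
    ext x
    simp only [mem_image, mem_Ioi, mem_Ioo]
    constructor
    · rintro ⟨u, hu, rfl⟩
      exact ⟨by positivity, by rw [div_lt_one (by positivity)]; linarith⟩
    · rintro ⟨hx0, hx1⟩
      have : 0 < 1 - x := by linarith
      exact ⟨x / (1 - x), by positivity, by field_simp; ring⟩
  have hder : ∀ u ∈ Ioi (0 : ℝ),
      HasDerivWithinAt (fun u : ℝ => u / (1 + u)) (1 / (1 + u) ^ 2) (Ioi 0) u := by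
    intro u hu
    have hu' : (1 + u) ≠ 0 := by have := mem_Ioi.1 hu; positivity
    have := ((hasDerivAt_id u).div ((hasDerivAt_id u).const_add 1) hu').hasDerivWithinAt (s := Ioi 0)
    rwa [show (1 * (1 + id u) - id u * 1) / (1 + id u) ^ 2 = 1 / (1 + u) ^ 2 by simp] at this
  have hinj : InjOn (fun u : ℝ => u / (1 + u)) (Ioi 0) := by
    intro u hu v hv h
    have hu' : (1 + u) ≠ 0 := by have := mem_Ioi.1 hu; positivity
    have hv' : (1 + v) ≠ 0 := by have := mem_Ioi.1 hv; positivity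
    rw [div_eq_div_iff hu' hv'] at h
    linarith
  rw [← hbeta, Complex.betaIntegral, intervalIntegral.integral_of_le zero_le_one,
    integral_Ioc_eq_integral_Ioo, ← himg,
    integral_image_eq_integral_abs_deriv_smul measurableSet_Ioi hder hinj]
  refine setIntegral_congr_fun measurableSet_Ioi fun u hu => ?_
  have hu0 : 0 < u := hu
  have hv0 : 0 < 1 + u := by positivity
  have hvne : (1 + (u : ℂ)) ≠ 0 := by exact_mod_cast hv0.ne'
  have e1 : 1 - ((u / (1 + u) : ℝ) : ℂ) = (((1 + u)⁻¹ : ℝ) : ℂ) := by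
    push_cast; field_simp; ring
  have e2 : ((u / (1 + u) : ℝ) : ℂ) ^ (a - 1) = (u : ℂ) ^ (a - 1) * ((1 + u : ℝ) : ℂ) ^ (1 - a) := by
    rw [div_eq_mul_inv, Complex.ofReal_mul, Complex.mul_cpow_ofReal_nonneg hu0.le (by positivity),
      Complex.ofReal_inv, Complex.inv_cpow, ← Complex.cpow_neg, neg_sub]
    rw [Complex.arg_ofReal_of_nonneg hv0.le]; exact Real.pi_pos.ne
  have e3 : (((1 + u)⁻¹ : ℝ) : ℂ) ^ (1 - a - 1) = ((1 + u : ℝ) : ℂ) ^ a := by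
    rw [Complex.ofReal_inv, Complex.inv_cpow, ← Complex.cpow_neg]
    · congr 1; ring
    rw [Complex.arg_ofReal_of_nonneg hv0.le]; exact Real.pi_pos.ne
  have e4 : ((1 + u : ℝ) : ℂ) ^ (1 - a) * ((1 + u : ℝ) : ℂ) ^ a = 1 + (u : ℂ) := by
    rw [← Complex.cpow_add _ _ (by exact_mod_cast hv0.ne')]
    simp
  rw [e1, e2, e3, mul_assoc, e4, abs_of_pos (by positivity), Complex.real_smul]
  push_cast
  field_simp

lemma mem_integerComplement_of_re {a : ℂ} (h0 : 0 < a.re) (h1 : a.re < 1) :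
    a ∈ Complex.integerComplement := by
  rw [Complex.integerComplement]
  rintro ⟨n, rfl⟩
  simp only [Complex.intCast_re] at h0 h1
  have h2 : (0 : ℤ) < n := by exact_mod_cast h0
  have h3 : n < (1 : ℤ) := by exact_mod_cast h1
  omega

lemma tendsto_sum_sub_pi_mul_cot {a : ℂ} (h0 : 0 < a.re) (h1 : a.re < 1) :
    Tendsto (fun N : ℕ => ∑ n ∈ Finset.range N, (1 / (n + a) - 1 / (n + 1 - a))) atTop
      (𝓝 (Real.pi * Complex.cot (Real.pi * a))) := by
  rw [← tendsto_add_atTop_iff_nat 1]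
  have hsum : ∀ N : ℕ, ∑ n ∈ Finset.range (N + 1), (1 / (n + a) - 1 / (n + 1 - a)) =
      1 / a + ∑ n ∈ Finset.range N, cotTerm a n - 1 / ((N : ℂ) + 1 - a) := by
    intro N
    induction N with
    | zero => simp
    | succ N ih =>
      rw [Finset.sum_range_succ, ih, Finset.sum_range_succ, cotTerm,
        show a - ((N : ℂ) + 1) = -((N : ℂ) + 1 - a) by ring, one_div_neg_eq_neg_one_div]
      push_cast
      ring
  simp only [hsum]
  have hlim : Tendsto (fun N : ℕ => 1 / ((N : ℂ) + 1 - a)) atTop (𝓝 0) := by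
    simp only [one_div]
    refine tendsto_inv₀_cobounded.comp (tendsto_norm_atTop_iff_cobounded.1 ?_)
    refine tendsto_atTop_mono (fun N => ?_) tendsto_natCast_atTop_atTop
    calc (N : ℝ) ≤ ((N : ℂ) + 1 - a).re := by simp; linarith
      _ ≤ _ := Complex.re_le_norm _
  have := ((tendsto_logDeriv_euler_cot_sub (mem_integerComplement_of_re h0 h1)).const_add
    (1 / a)).sub hlim
  simpa using this

lemma integral_Ioc_cpowGap_div {a : ℂ} (h0 : 0 < a.re) (h1 : a.re < 1)
    (hint : IntegrableOn (fun u : ℝ => cpowGap a u / (1 - (u : ℂ))) (Ioi 0)) :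
    ∫ u in Ioc (0 : ℝ) 1, cpowGap a u / (1 - (u : ℂ)) =
      Real.pi * Complex.cot (Real.pi * a) := by
  have hpow : ∀ (n : ℕ) (p : ℂ), -1 < p.re →
      IntegrableOn (fun u : ℝ => (u : ℂ) ^ p * (u : ℂ) ^ n) (Ioc 0 1) ∧
      ∫ u in Ioc (0 : ℝ) 1, (u : ℂ) ^ p * (u : ℂ) ^ n = 1 / (n + 1 + p) := by
    intro n p hp
    have hre : -1 < (p + n).re := by
      simp only [Complex.add_re, Complex.natCast_re]; linarith [Nat.cast_nonneg (α := ℝ) n]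
    have hcongr : EqOn (fun u : ℝ => (u : ℂ) ^ p * (u : ℂ) ^ n) (fun u : ℝ => (u : ℂ) ^ (p + n))
        (Ioc 0 1) := by
      intro u hu
      have : (u : ℂ) ≠ 0 := by exact_mod_cast hu.1.ne'
      simp [Complex.cpow_add _ _ this]
    have hne : p + n + 1 ≠ 0 := by
      intro h
      have := congrArg Complex.re h
      simp only [Complex.add_re, Complex.one_re, Complex.zero_re] at this hre
      linarith
    refine ⟨(integrableOn_congr_fun hcongr measurableSet_Ioc).2
      (intervalIntegral.intervalIntegrable_cpow' hre).1, ?_⟩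
    rw [setIntegral_congr_fun measurableSet_Ioc hcongr,
      ← intervalIntegral.integral_of_le zero_le_one, integral_cpow (Or.inl hre)]
    rw [Complex.ofReal_one, Complex.one_cpow, Complex.ofReal_zero, Complex.zero_cpow hne, sub_zero]
    congr 1; ring
  refine tendsto_nhds_unique ?_ (tendsto_sum_sub_pi_mul_cot h0 h1)
  have hN : ∀ N : ℕ, ∑ n ∈ Finset.range N, (1 / (n + a) - 1 / (n + 1 - a)) =
      ∫ u in Ioc (0 : ℝ) 1, cpowGap a u * ∑ n ∈ Finset.range N, (u : ℂ) ^ n := by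
    intro N
    simp only [Finset.mul_sum, cpowGap, sub_mul]
    rw [integral_finsetSum]
    · refine Finset.sum_congr rfl fun n _ => ?_
      rw [integral_sub (hpow n (a - 1) (by simpa using h0)).1
        (hpow n (-a) (by simpa using h1)).1, (hpow n (a - 1) (by simpa using h0)).2,
        (hpow n (-a) (by simpa using h1)).2]
      congr 2; ring
    · intro n _
      exact (hpow n (a - 1) (by simpa using h0)).1.sub (hpow n (-a) (by simpa using h1)).1
  simp only [hN]
  have hae : ∀ᵐ u ∂(volume.restrict (Ioc (0 : ℝ) 1)), u ∈ Ioo (0 : ℝ) 1 := by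
    rw [← restrict_Ioo_eq_restrict_Ioc]
    exact ae_restrict_mem measurableSet_Ioo
  have hgeom : ∀ u ∈ Ioo (0 : ℝ) 1, ∀ N : ℕ, cpowGap a u * ∑ n ∈ Finset.range N, (u : ℂ) ^ n =
      cpowGap a u / (1 - (u : ℂ)) * (1 - (u : ℂ) ^ N) := by
    intro u hu N
    have hu1 : (u : ℂ) ≠ 1 := by exact_mod_cast hu.2.ne
    have : (1 - (u : ℂ)) ≠ 0 := sub_ne_zero.2 hu1.symm
    have h := mul_neg_geom_sum (u : ℂ) N
    rw [← h]
    field_simp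
  refine tendsto_integral_of_dominated_convergence
    (fun u => ‖cpowGap a u / (1 - (u : ℂ))‖) (fun N => ?_)
    (hint.mono_set Ioc_subset_Ioi_self).norm (fun N => ?_) ?_
  · refine Measurable.aestronglyMeasurable ((measurable_cpowGap a).mul ?_)
    fun_prop
  · filter_upwards [hae] with u hu
    rw [hgeom u hu, norm_mul]
    refine mul_le_of_le_one_right (norm_nonneg _) ?_
    have : (1 - (u : ℂ) ^ N) = ((1 - u ^ N : ℝ) : ℂ) := by push_cast; rfl
    rw [this, Complex.norm_real, Real.norm_eq_abs, abs_le]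
    have h2 := pow_le_one₀ (n := N) hu.1.le hu.2.le
    have h3 := pow_nonneg hu.1.le N
    constructor <;> linarith
  · filter_upwards [hae] with u hu
    have hlim : Tendsto (fun N : ℕ => (u : ℂ) ^ N) atTop (𝓝 0) :=
      tendsto_pow_atTop_nhds_zero_of_norm_lt_one
        (by rw [Complex.norm_real, Real.norm_eq_abs, abs_of_pos hu.1]; exact hu.2)
    have := (hlim.const_sub 1).const_mul (cpowGap a u / (1 - (u : ℂ)))
    simp only [hgeom u hu]
    simpa using this

lemma integrableOn_cpowGap_div_one_sub_sq {a : ℂ} (h0 : 0 < a.re) (h1 : a.re < 1) :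
    IntegrableOn (fun u : ℝ => cpowGap a u / (1 - (u : ℂ) ^ 2)) (Ioi 0) := by
  have hmax : max a.re (1 - a.re) < 1 := max_lt h1 (by linarith)
  obtain ⟨p, hp, hp1⟩ := exists_between hmax
  refine integrableOn_Ioi_of_norm_le_rpow
    ((measurable_cpowGap a).div (by fun_prop)).stronglyMeasurable hp1
    (q := 3 / 2) (by norm_num) (fun t ht => norm_cpowGap_div_le ht ?_ ?_ ?_ ?_)
    (fun t ht => norm_cpowGap_div_le ht ?_ ?_ ?_ ?_)
  all_goals have := max_lt_iff.1 hp; linarith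

lemma integrableOn_cpowGap_div_one_sub {a : ℂ} (h0 : 0 < a.re) (h1 : a.re < 1) :
    IntegrableOn (fun u : ℝ => cpowGap a u / (1 - (u : ℂ))) (Ioi 0) := by
  have hmin : 2 < min (2 + a.re) (3 - a.re) := lt_min (by linarith) (by linarith)
  obtain ⟨q, hq2, hq⟩ := exists_between hmin
  have hq' := lt_min_iff.1 hq
  have hbd : ∀ {k : ℝ}, 1 < k → k < 2 + a.re → k < 3 - a.re → ∀ t : ℝ, 0 < t →
      ‖(t : ℂ) * (cpowGap a t / (1 - (t : ℂ) ^ 2))‖ ≤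
        ‖2 * a - 1‖ * logGapConst a.re k * t ^ (-(k - 1)) := by
    intro k hk hk1 hk2 t ht
    rw [norm_mul, Complex.norm_real, Real.norm_eq_abs, abs_of_pos ht]
    calc _ ≤ t * (‖2 * a - 1‖ * logGapConst a.re k * t ^ (-k)) :=
          mul_le_mul_of_nonneg_left
            (norm_cpowGap_div_le ht (by linarith) (by linarith) hk2 hk1) ht.le
      _ = ‖2 * a - 1‖ * logGapConst a.re k * (t ^ (1 : ℝ) * t ^ (-k)) := by
          rw [Real.rpow_one]; ring
      _ = _ := by rw [← Real.rpow_add ht]; congr 2; ring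
  have hmul : IntegrableOn (fun u : ℝ => (u : ℂ) * (cpowGap a u / (1 - (u : ℂ) ^ 2))) (Ioi 0) :=
    integrableOn_Ioi_of_norm_le_rpow
      (Complex.measurable_ofReal.mul
        ((measurable_cpowGap a).div (by fun_prop))).stronglyMeasurable
      (p := 3 / 2 - 1) (q := q - 1) (by norm_num) (by linarith)
      (hbd (by norm_num) (by linarith) (by linarith)) (hbd (by linarith) hq'.1 hq'.2)
  refine ((integrableOn_cpowGap_div_one_sub_sq h0 h1).add hmul).congr_fun (fun u hu => ?_)
    measurableSet_Ioi
  have hu0 : (0 : ℝ) < u := hu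
  have h2 : (1 + (u : ℂ)) ≠ 0 := by exact_mod_cast (by positivity : (1 + u : ℝ) ≠ 0)
  by_cases h3 : (1 - (u : ℂ)) = 0
  · simp [h3, show 1 - (u : ℂ) ^ 2 = (1 - (u : ℂ)) * (1 + u) by ring]
  · simp only [Pi.add_apply, show 1 - (u : ℂ) ^ 2 = (1 - (u : ℂ)) * (1 + u) by ring]
    field_simp

lemma integral_Ioi_comp_inv (F : ℝ → ℂ) :
    ∫ u in Ioi (0 : ℝ), ((u ^ 2)⁻¹ : ℝ) • F u⁻¹ = ∫ u in Ioi (0 : ℝ), F u := by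
  rw [← integral_comp_rpow_Ioi F (p := -1) (by norm_num)]
  refine setIntegral_congr_fun measurableSet_Ioi fun u hu => ?_
  have hu0 : (0 : ℝ) < u := hu
  simp only [Real.rpow_neg_one]
  congr 1
  norm_num

lemma integral_cpowGap_div_one_sub {a : ℂ} (h0 : 0 < a.re) (h1 : a.re < 1) :
    ∫ u in Ioi (0 : ℝ), cpowGap a u / (1 - (u : ℂ)) =
      2 * (Real.pi * Complex.cot (Real.pi * a)) := by
  have hint := integrableOn_cpowGap_div_one_sub h0 h1
  have hinv : ∀ u : ℝ, 0 < u → ((u ^ 2)⁻¹ : ℝ) • (cpowGap a u⁻¹ / (1 - ((u⁻¹ : ℝ) : ℂ))) =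
      cpowGap a u / (1 - (u : ℂ)) := by
    intro u hu
    have hu0 : (u : ℂ) ≠ 0 := by exact_mod_cast hu.ne'
    have harg : (u : ℂ).arg ≠ Real.pi := by
      rw [Complex.arg_ofReal_of_nonneg hu.le]; exact Real.pi_pos.ne
    by_cases h3 : (1 - (u : ℂ)) = 0
    · have : (u : ℂ) = 1 := (sub_eq_zero.1 h3).symm
      simp [this]
    · have e1 : ((u⁻¹ : ℝ) : ℂ) ^ (a - 1) = (u : ℂ) ^ (-a) * u := by
        rw [Complex.ofReal_inv, Complex.inv_cpow _ _ harg, ← Complex.cpow_neg,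
          show -(a - 1) = -a + 1 by ring, Complex.cpow_add _ _ hu0, Complex.cpow_one]
      have e2 : ((u⁻¹ : ℝ) : ℂ) ^ (-a) = (u : ℂ) ^ (a - 1) * u := by
        rw [Complex.ofReal_inv, Complex.inv_cpow _ _ harg, ← Complex.cpow_neg,
          show - -a = (a - 1) + 1 by ring, Complex.cpow_add _ _ hu0, Complex.cpow_one]
      have h4 : (u : ℂ) - 1 ≠ 0 := fun h => h3 (by linear_combination -h)
      rw [cpowGap, e1, e2, Complex.real_smul, cpowGap]
      push_cast
      rw [show (1 - (u : ℂ)⁻¹) = ((u : ℂ) - 1) / u by field_simp,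
        show (1 - (u : ℂ)) = -((u : ℂ) - 1) by ring]
      field_simp
      ring
  have hsplit : ∫ u in Ioi (0 : ℝ), cpowGap a u / (1 - (u : ℂ)) =
      (∫ u in Ioc (0 : ℝ) 1, cpowGap a u / (1 - (u : ℂ))) +
        ∫ u in Ioi (1 : ℝ), cpowGap a u / (1 - (u : ℂ)) := by
    rw [← Ioc_union_Ioi_eq_Ioi zero_le_one, setIntegral_union Ioc_disjoint_Ioi_same
      measurableSet_Ioi (hint.mono_set Ioc_subset_Ioi_self)
      (hint.mono_set (Ioi_subset_Ioi zero_le_one))]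
  have hfold : ∫ u in Ioi (1 : ℝ), cpowGap a u / (1 - (u : ℂ)) =
      ∫ u in Ioo (0 : ℝ) 1, cpowGap a u / (1 - (u : ℂ)) := by
    have h := integral_Ioi_comp_inv ((Ioi 1).indicator fun u => cpowGap a u / (1 - (u : ℂ)))
    rw [setIntegral_indicator measurableSet_Ioi, Ioi_inter_Ioi] at h
    simp only [zero_le_one, sup_of_le_right] at h
    rw [← h, ← Ioi_inter_Iio, ← setIntegral_indicator measurableSet_Iio]
    refine setIntegral_congr_fun measurableSet_Ioi fun u hu => ?_
    have hu0 : (0 : ℝ) < u := hu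
    simp only [indicator_apply, mem_Ioi, mem_Iio, one_lt_inv₀ hu0]
    split_ifs
    · exact hinv u hu0
    · simp
  rw [hsplit, hfold, ← integral_Ioc_eq_integral_Ioo, integral_Ioc_cpowGap_div h0 h1 hint, two_mul]

lemma norm_ofReal_add {t u : ℝ} (ht : 0 < t) (hu : 0 < u) : ‖(t : ℂ) + u‖ = t + u := by
  rw [← Complex.ofReal_add, Complex.norm_real, Real.norm_eq_abs, abs_of_pos (by positivity)]

lemma ofReal_add_ne_zero {t u : ℝ} (ht : 0 < t) (hu : 0 < u) : (t : ℂ) + u ≠ 0 := by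
  exact_mod_cast (by positivity : t + u ≠ 0)

lemma integrableOn_cpow_div_add {a : ℂ} {t : ℝ} (h0 : 0 < a.re) (h1 : a.re < 1) (ht : 0 < t) :
    IntegrableOn (fun u : ℝ => (u : ℂ) ^ (a - 1) / ((t : ℂ) + u)) (Ioi 0) := by
  refine integrableOn_Ioi_of_norm_le_rpow (A := 1 / t) (B := 1) (p := 1 - a.re) (q := 2 - a.re)
    ((measurable_ofReal_cpow _).div (by fun_prop)).stronglyMeasurable (by linarith) (by linarith)
    (fun u hu => ?_) (fun u hu => ?_)
  all_goals
    rw [norm_div, norm_ofReal_add ht hu, Complex.norm_cpow_eq_rpow_re_of_pos hu, Complex.sub_re,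
      Complex.one_re]
  · rw [neg_sub, one_div_mul_eq_div]
    gcongr
    linarith
  · calc _ ≤ u ^ (a.re - 1) / u := by gcongr; linarith
      _ = _ := by
        rw [one_mul, show -(2 - a.re) = a.re - 1 - 1 by ring, Real.rpow_sub_one hu.ne' (a.re - 1)]

lemma integral_cpow_div_add {a : ℂ} {t : ℝ} (h0 : 0 < a.re) (h1 : a.re < 1) (ht : 0 < t) :
    ∫ u in Ioi (0 : ℝ), (u : ℂ) ^ (a - 1) / ((t : ℂ) + u) =
      (t : ℂ) ^ (a - 1) * (Real.pi / Complex.sin (Real.pi * a)) := by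
  have h := integral_comp_mul_left_Ioi' (fun u : ℝ => (u : ℂ) ^ (a - 1) / ((t : ℂ) + u)) 0 ht
  rw [mul_zero] at h
  rw [← h, ← integral_cpow_div_one_add h0 h1, ← integral_smul, ← integral_const_mul]
  refine setIntegral_congr_fun measurableSet_Ioi fun u hu => ?_
  have hu0 : (0 : ℝ) < u := hu
  have ht0 : (t : ℂ) ≠ 0 := by exact_mod_cast ht.ne'
  have hv : (1 + (u : ℂ)) ≠ 0 := by exact_mod_cast (by positivity : (1 + u : ℝ) ≠ 0)
  simp only [Complex.real_smul, Complex.ofReal_mul]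
  rw [Complex.mul_cpow_ofReal_nonneg ht.le hu0.le,
    show (t : ℂ) + t * u = t * (1 + u) by ring]
  field_simp

lemma cpowGap_div_eq (a : ℂ) (t u : ℝ) : cpowGap a u / ((t : ℂ) + u) =
    (u : ℂ) ^ (a - 1) / ((t : ℂ) + u) - (u : ℂ) ^ ((1 - a) - 1) / ((t : ℂ) + u) := by
  rw [cpowGap, sub_div, show (1 - a) - 1 = -a by ring]

lemma integrableOn_cpowGap_div_add {a : ℂ} {t : ℝ} (h0 : 0 < a.re) (h1 : a.re < 1) (ht : 0 < t) :
    IntegrableOn (fun u : ℝ => cpowGap a u / ((t : ℂ) + u)) (Ioi 0) := by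
  simp only [cpowGap_div_eq]
  exact (integrableOn_cpow_div_add h0 h1 ht).sub
    (integrableOn_cpow_div_add (by simpa using h1) (by simpa using h0) ht)

lemma integral_cpowGap_div_add {a : ℂ} {t : ℝ} (h0 : 0 < a.re) (h1 : a.re < 1) (ht : 0 < t) :
    ∫ u in Ioi (0 : ℝ), cpowGap a u / ((t : ℂ) + u) =
      cpowGap a t * (Real.pi / Complex.sin (Real.pi * a)) := by
  have h0' : 0 < (1 - a).re := by simpa using h1
  have h1' : (1 - a).re < 1 := by simpa using h0
  simp only [cpowGap_div_eq]
  rw [integral_sub (integrableOn_cpow_div_add h0 h1 ht) (integrableOn_cpow_div_add h0' h1' ht),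
    integral_cpow_div_add h0 h1 ht, integral_cpow_div_add h0' h1' ht, mul_sub, mul_one,
    Complex.sin_pi_sub, cpowGap, sub_mul, show 1 - a - 1 = -a by ring]

lemma integral_cpowGap_div_mul {a : ℂ} {t : ℝ} (h0 : 0 < a.re) (h1 : a.re < 1) (ht : 0 < t)
    (ht1 : t ≠ 1) : ∫ u in Ioi (0 : ℝ), cpowGap a u / (1 - (u : ℂ) ^ 2) / ((t : ℂ) + u) =
      Real.pi * Complex.cot (Real.pi * a) / (1 + t) +
        cpowGap a t / (1 - (t : ℂ) ^ 2) * (Real.pi / Complex.sin (Real.pi * a)) := by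
  have hgap1 : cpowGap a 1 = 0 := by simp [cpowGap]
  have ht2 : (1 : ℂ) + t ≠ 0 := by
    simpa using ofReal_add_ne_zero one_pos ht
  have ht3 : (1 : ℂ) - t ≠ 0 := by
    rw [sub_ne_zero]; exact_mod_cast ht1.symm
  have hfrac : ∀ u ∈ Ioi (0 : ℝ), cpowGap a u / (1 - (u : ℂ) ^ 2) / ((t : ℂ) + u) =
      1 / (2 * (1 + (t : ℂ))) * (cpowGap a u / (1 - (u : ℂ))) -
        1 / (2 * (1 - (t : ℂ))) * (cpowGap a u / (((1 : ℝ) : ℂ) + u)) +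
        1 / (1 - (t : ℂ) ^ 2) * (cpowGap a u / ((t : ℂ) + u)) := by
    intro u hu
    have hu0 : (0 : ℝ) < u := hu
    by_cases hu1 : u = 1
    · simp [hu1, hgap1]
    have e1 : (1 : ℂ) - u ≠ 0 := by
      rw [sub_ne_zero]; exact_mod_cast Ne.symm hu1
    have e2 := ofReal_add_ne_zero one_pos hu0
    have e3 := ofReal_add_ne_zero ht hu0
    rw [Complex.ofReal_one] at e2 ⊢
    rw [show 1 - (u : ℂ) ^ 2 = (1 - (u : ℂ)) * (1 + u) by ring,
      show 1 - (t : ℂ) ^ 2 = (1 - (t : ℂ)) * (1 + t) by ring]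
    field_simp
    ring
  have i1 := (integrableOn_cpowGap_div_one_sub h0 h1).const_mul (1 / (2 * (1 + (t : ℂ))))
  have i2 := (integrableOn_cpowGap_div_add h0 h1 one_pos).const_mul (1 / (2 * (1 - (t : ℂ))))
  have i3 := (integrableOn_cpowGap_div_add h0 h1 ht).const_mul (1 / (1 - (t : ℂ) ^ 2))
  have i12 : IntegrableOn (fun u : ℝ => 1 / (2 * (1 + (t : ℂ))) * (cpowGap a u / (1 - (u : ℂ))) -
      1 / (2 * (1 - (t : ℂ))) * (cpowGap a u / (((1 : ℝ) : ℂ) + u))) (Ioi 0) := i1.sub i2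
  rw [setIntegral_congr_fun measurableSet_Ioi hfrac, integral_add i12 i3,
    integral_sub i1 i2, integral_const_mul, integral_const_mul, integral_const_mul,
    integral_cpowGap_div_add h0 h1 ht, integral_cpowGap_div_add h0 h1 one_pos,
    integral_cpowGap_div_one_sub h0 h1, hgap1]
  field_simp
  ring

lemma cos_pi_mul_ne_zero {α : ℂ} (h0 : 0 < α.re) (h1 : α.re < 1) (hα : α ≠ 1 / 2) :
    Complex.cos (Real.pi * α) ≠ 0 := by
  rw [Complex.cos_ne_zero_iff]
  intro n h
  have hpi : (Real.pi : ℂ) ≠ 0 := by exact_mod_cast Real.pi_ne_zero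
  have h2 : α = (2 * n + 1) / 2 := by
    apply mul_left_cancel₀ hpi
    rw [h]; ring
  have h3 : α = (((2 * n + 1) / 2 : ℝ) : ℂ) := by rw [h2]; push_cast; ring
  have h4 := congrArg Complex.re h3
  rw [Complex.ofReal_re] at h4
  have h5 : (-1 : ℝ) < n := by linarith
  have h6 : (n : ℝ) < 1 := by linarith
  have h7 : (-1 : ℤ) < n := by exact_mod_cast h5
  have h8 : n < (1 : ℤ) := by exact_mod_cast h6
  have : n = 0 := by omega
  apply hα
  rw [h2, this]; simp

lemma r2_eq_cpowGap {α : ℂ} (hα : α ≠ 1 / 2) {u : ℝ} (hu : 0 < u) :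
    r2 α u = -(1 / Complex.cos (Real.pi * α)) * (cpowGap α u / (1 - (u : ℂ) ^ 2)) := by
  have hu0 : (u : ℂ) ≠ 0 := by exact_mod_cast hu.ne'
  have e1 : (u : ℂ) ^ α = u ^ (α - 1) * u := by
    rw [Complex.cpow_sub _ _ hu0, Complex.cpow_one]; field_simp
  have e2 : (u : ℂ) ^ (-α + 1) = u ^ (-α) * u := by
    rw [Complex.cpow_add _ _ hu0, Complex.cpow_one]
  rw [r2, r1, if_neg (by simpa using hα), neg_neg, mul_neg, Complex.cos_neg, e1, e2, cpowGap]
  field_simp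

lemma r2_half {u : ℝ} (hu : 0 < u) : r2 (1 / 2) u =
    2 / Real.pi * ((u : ℂ) ^ (-(1 / 2) : ℂ) * Real.log u) / (1 - (u : ℂ) ^ 2) := by
  have hu0 : (u : ℂ) ≠ 0 := by exact_mod_cast hu.ne'
  have e1 : (u : ℂ) ^ (1 / 2 : ℂ) = u ^ (-(1 / 2) : ℂ) * u := by
    rw [show (1 / 2 : ℂ) = -(1 / 2) + 1 by norm_num, Complex.cpow_add _ _ hu0, Complex.cpow_one]
    norm_num
  rw [r2, r1, if_pos rfl, e1]
  field_simp

lemma resolvent_identity_of_ne_half {α : ℂ} (h0 : 0 < α.re) (h1 : α.re < 1) (hα : α ≠ 1 / 2)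
    {t : ℝ} (ht : 0 < t) (ht1 : t ≠ 1) :
    Complex.sin (Real.pi * α) / Real.pi * ∫ u in Ioi (0 : ℝ), r2 α u / ((t : ℂ) + u) =
      r2 α t - 1 / (1 + (t : ℂ)) := by
  have hcos := cos_pi_mul_ne_zero h0 h1 hα
  have hsin := sin_pi_mul_ne_zero (mem_integerComplement_of_re h0 h1)
  have hpi : (Real.pi : ℂ) ≠ 0 := by exact_mod_cast Real.pi_ne_zero
  have hcongr : EqOn (fun u : ℝ => r2 α u / ((t : ℂ) + u)) (fun u : ℝ =>
      -(1 / Complex.cos (Real.pi * α)) * (cpowGap α u / (1 - (u : ℂ) ^ 2) / ((t : ℂ) + u)))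
      (Ioi 0) := fun u hu => by
    simp only [r2_eq_cpowGap hα hu, mul_div_assoc]
  rw [setIntegral_congr_fun measurableSet_Ioi hcongr, integral_const_mul,
    integral_cpowGap_div_mul h0 h1 ht ht1, r2_eq_cpowGap hα ht, Complex.cot]
  field_simp
  ring

lemma exists_norm_r2_le {α : ℂ} (h0 : 0 < α.re) (h1 : α.re ≤ 1 / 2) {k : ℝ} (hk1 : 1 - α.re < k)
    (hk2 : k ≤ 2) : ∃ C, ∀ t : ℝ, 0 < t → ‖r2 α t‖ ≤ C * t ^ (-k) := by
  by_cases hα : α = 1 / 2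
  · subst hα
    have hre : ((1 / 2 : ℂ)).re = 1 / 2 := by norm_num
    rw [hre] at hk1
    refine ⟨1 / Real.pi * logGapConst (1 / 2) k, fun t ht => ?_⟩
    have hn : ‖1 - (t : ℂ) ^ 2‖ = |1 - t ^ 2| := by
      rw [← Real.norm_eq_abs, ← Complex.norm_real]; push_cast; rfl
    have h := log_gap_le (t := t) (σ := 1 / 2) (k := k) ht (by linarith) (by linarith)
      (by linarith) (by linarith)
    have hpi := Real.pi_pos
    rw [r2_half ht, norm_div, norm_mul, norm_mul, norm_div, hn,
      Complex.norm_cpow_eq_rpow_re_of_pos ht, Complex.neg_re, hre, Complex.norm_real,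
      Complex.norm_real, Real.norm_eq_abs, Real.norm_eq_abs, abs_of_pos hpi, Complex.norm_ofNat]
    calc _ = 1 / Real.pi * ((t ^ ((1 / 2 : ℝ) - 1) + t ^ (-(1 / 2 : ℝ))) *
          (|Real.log t| / |1 - t ^ 2|)) := by
          rw [show (1 / 2 : ℝ) - 1 = -(1 / 2) by norm_num]; ring
      _ ≤ _ := by
          rw [mul_assoc]; exact mul_le_mul_of_nonneg_left h (by positivity)
  · refine ⟨‖-(1 / Complex.cos (Real.pi * α))‖ * (‖2 * α - 1‖ * logGapConst α.re k),
      fun t ht => ?_⟩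
    rw [r2_eq_cpowGap hα ht, norm_mul, mul_assoc]
    exact mul_le_mul_of_nonneg_left (norm_cpowGap_div_le ht (by linarith) (by linarith)
      (by linarith) (by linarith)) (norm_nonneg _)

lemma hasDerivAt_cos_pi_mul_half :
    HasDerivAt (fun a : ℝ => Complex.cos (Real.pi * a)) (-(Real.pi : ℂ)) (1 / 2) := by
  have d : HasDerivAt (fun z : ℂ => Complex.cos (Real.pi * z)) (-(Real.pi : ℂ))
      ((1 / 2 : ℝ) : ℂ) := by
    have e := ((hasDerivAt_id (((1 / 2 : ℝ) : ℂ))).const_mul (Real.pi : ℂ)).ccos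
    refine e.congr_deriv ?_
    rw [id, show (Real.pi : ℂ) * ((1 / 2 : ℝ) : ℂ) = Real.pi / 2 by push_cast; ring,
      Complex.sin_pi_div_two]
    ring
  exact d.comp_ofReal

lemma tendsto_r2_half {u : ℝ} (hu : 0 < u) :
    Tendsto (fun a : ℝ => r2 a u) (𝓝[≠] (1 / 2)) (𝓝 (r2 (1 / 2) u)) := by
  have hu0 : (u : ℂ) ≠ 0 := by exact_mod_cast hu.ne'
  have hpi : (Real.pi : ℂ) ≠ 0 := by exact_mod_cast Real.pi_ne_zero
  have hgap : HasDerivAt (fun a : ℝ => cpowGap a u)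
      (2 * ((u : ℂ) ^ (-(1 / 2) : ℂ) * Real.log u)) (1 / 2) := by
    have d1 : HasDerivAt (fun z : ℂ => (u : ℂ) ^ (z - 1) - (u : ℂ) ^ (-z))
        (2 * ((u : ℂ) ^ (-(1 / 2) : ℂ) * Real.log u)) ((1 / 2 : ℝ) : ℂ) := by
      have e1 := ((hasDerivAt_id (((1 / 2 : ℝ) : ℂ))).sub_const 1).const_cpow (c := (u : ℂ))
        (Or.inl hu0)
      have e2 := (hasDerivAt_id (((1 / 2 : ℝ) : ℂ))).neg.const_cpow (c := (u : ℂ)) (Or.inl hu0)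
      refine (e1.sub e2).congr_deriv ?_
      simp only [id, Pi.neg_apply]
      rw [Complex.ofReal_log hu.le, show ((1 / 2 : ℝ) : ℂ) - 1 = -(1 / 2) by push_cast; ring,
        show -((1 / 2 : ℝ) : ℂ) = -(1 / 2) by push_cast; ring]
      ring
    exact d1.comp_ofReal
  have hcos := hasDerivAt_cos_pi_mul_half
  have s1 := hasDerivAt_iff_tendsto_slope.1 hgap
  have s2 := hasDerivAt_iff_tendsto_slope.1 hcos
  have hlim : Tendsto (fun a : ℝ => -(slope (fun a : ℝ => cpowGap a u) (1 / 2) a /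
      slope (fun a : ℝ => Complex.cos (Real.pi * a)) (1 / 2) a) / (1 - (u : ℂ) ^ 2)) _ _ :=
    ((s1.div s2 (neg_ne_zero.2 hpi)).neg).div_const (1 - (u : ℂ) ^ 2)
  rw [r2_half hu]
  convert hlim.congr' ?_ using 2
  · field_simp
  · filter_upwards [self_mem_nhdsWithin] with a ha
    have ha' : a - 1 / 2 ≠ 0 := sub_ne_zero.2 ha
    have ha2 : (a : ℂ) ≠ 1 / 2 := by
      intro h
      exact ha (by
        have := congrArg Complex.re h
        simpa using this)
    have c0 : Complex.cos (Real.pi * ((1 / 2 : ℝ) : ℂ)) = 0 := by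
      rw [show (Real.pi : ℂ) * ((1 / 2 : ℝ) : ℂ) = Real.pi / 2 by push_cast; ring,
        Complex.cos_pi_div_two]
    have g0 : cpowGap ((1 / 2 : ℝ) : ℂ) u = 0 := by
      rw [cpowGap, sub_eq_zero]
      congr 1
      push_cast
      ring
    rw [r2_eq_cpowGap ha2 hu, slope_def_module, slope_def_module, c0,
      g0, sub_zero, sub_zero, Complex.real_smul, Complex.real_smul, mul_div_mul_left]
    · ring
    · exact_mod_cast inv_ne_zero ha'

lemma measurable_r2 (α : ℂ) : Measurable (r2 α) := by
  unfold r2 r1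
  have h := measurable_ofReal_cpow
  by_cases hα : -α = -(1 / 2 : ℂ)
  · simp only [if_pos hα]
    have := h (1 / 2)
    fun_prop
  · simp only [if_neg hα]
    have h1 := h (-(-α))
    have h2 := h (-α + 1)
    fun_prop

lemma eventually_norm_r2_le : ∃ C : ℝ, ∀ᶠ a : ℝ in 𝓝[≠] (1 / 2), ∀ u : ℝ, 0 < u →
    ‖r2 a u‖ ≤ C * u ^ (-(5 / 6) : ℝ) := by
  have s2 := (hasDerivAt_iff_tendsto_slope.1 hasDerivAt_cos_pi_mul_half).norm
  rw [norm_neg, Complex.norm_real, Real.norm_eq_abs, abs_of_pos Real.pi_pos] at s2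
  refine ⟨2 * logGapConst (1 / 3) (5 / 6), ?_⟩
  filter_upwards [s2.eventually_const_lt (lt_of_lt_of_le (by norm_num) Real.pi_gt_three.le :
    (2 : ℝ) < Real.pi), self_mem_nhdsWithin, mem_nhdsWithin_of_mem_nhds
    (Ioo_mem_nhds (by norm_num : (1 / 3 : ℝ) < 1 / 2) (by norm_num : (1 / 2 : ℝ) < 2 / 3))]
    with a hs ha hI u hu
  have ha' : a - 1 / 2 ≠ 0 := sub_ne_zero.2 ha
  have ha2 : (a : ℂ) ≠ 1 / 2 := fun h => ha (by simpa using congrArg Complex.re h)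
  have c0 : Complex.cos (Real.pi * ((1 / 2 : ℝ) : ℂ)) = 0 := by
    rw [show (Real.pi : ℂ) * ((1 / 2 : ℝ) : ℂ) = Real.pi / 2 by push_cast; ring,
      Complex.cos_pi_div_two]
  rw [slope_def_module, c0, sub_zero, norm_smul, norm_inv, Real.norm_eq_abs, lt_inv_mul_iff₀
    (abs_pos.2 ha')] at hs
  have hnum : ‖2 * (a : ℂ) - 1‖ = |a - 1 / 2| * 2 := by
    rw [show 2 * (a : ℂ) - 1 = ((2 * (a - 1 / 2) : ℝ) : ℂ) by push_cast; ring, Complex.norm_real,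
      Real.norm_eq_abs, abs_mul, abs_two, mul_comm]
  have hcos : 0 < ‖Complex.cos (Real.pi * a)‖ := lt_of_le_of_lt (by positivity) hs
  have hpow : ∀ b : ℝ, 1 / 3 < b → b < 2 / 3 →
      u ^ (-b) ≤ u ^ ((1 / 3 : ℝ) - 1) + u ^ (-(1 / 3) : ℝ) := by
    intro b hb1 hb2
    rcases le_total u 1 with hu1 | hu1
    · exact (Real.rpow_le_rpow_of_exponent_ge hu hu1 (by linarith)).trans
        (le_add_of_nonneg_right (by positivity))
    · exact (Real.rpow_le_rpow_of_exponent_le hu1 (by linarith)).trans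
        (le_add_of_nonneg_left (by positivity))
  have h1 := hpow (1 - a) (by linarith [hI.2]) (by linarith [hI.1])
  have h2 := hpow a hI.1 hI.2
  rw [neg_sub] at h1
  have hlog := log_gap_le (t := u) (σ := 1 / 3) (k := 5 / 6) hu (by norm_num) (by norm_num)
    (by norm_num) (by norm_num)
  have hgap := norm_cpowGap_div_le_log hu (a : ℂ)
  rw [Complex.ofReal_re, hnum] at hgap
  rw [r2_eq_cpowGap ha2 hu, norm_mul, norm_neg, norm_div, norm_one, one_div_mul_eq_div,
    div_le_iff₀ hcos]
  have hsum : (u ^ (a - 1) + u ^ (-a)) * (|Real.log u| / |1 - u ^ 2|) ≤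
      2 * logGapConst (1 / 3) (5 / 6) * u ^ (-(5 / 6) : ℝ) := by
    calc _ ≤ (2 * (u ^ ((1 / 3 : ℝ) - 1) + u ^ (-(1 / 3) : ℝ))) *
          (|Real.log u| / |1 - u ^ 2|) := by gcongr; linarith
      _ ≤ _ := by linarith
  exact hgap.trans ((mul_le_mul hs.le hsum (by positivity) hcos.le).trans_eq (mul_comm _ _))

lemma resolvent_identity_half {t : ℝ} (ht : 0 < t) (ht1 : t ≠ 1) :
    Complex.sin (Real.pi * (1 / 2)) / Real.pi * ∫ u in Ioi (0 : ℝ), r2 (1 / 2) u / ((t : ℂ) + u) =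
      r2 (1 / 2) t - 1 / (1 + (t : ℂ)) := by
  obtain ⟨C, hC⟩ := eventually_norm_r2_le
  have hint : Tendsto (fun a : ℝ => ∫ u in Ioi (0 : ℝ), r2 a u / ((t : ℂ) + u)) (𝓝[≠] (1 / 2))
      (𝓝 (∫ u in Ioi (0 : ℝ), r2 (1 / 2) u / ((t : ℂ) + u))) := by
    refine tendsto_integral_filter_of_dominated_convergence
      (fun u => |C| * u ^ (-(5 / 6) : ℝ) / (t + u)) (Eventually.of_forall fun a =>
        ((measurable_r2 a).div (by fun_prop)).aestronglyMeasurable) ?_ ?_ ?_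
    · filter_upwards [hC] with a ha
      refine (ae_restrict_iff' measurableSet_Ioi).2 (Eventually.of_forall fun u hu => ?_)
      have hu0 : (0 : ℝ) < u := hu
      rw [norm_div, norm_ofReal_add ht hu0]
      have := (ha u hu0).trans (mul_le_mul_of_nonneg_right (le_abs_self C) (by positivity))
      gcongr
    · refine integrableOn_Ioi_of_norm_le_rpow (A := |C| / t) (B := |C|) (p := 5 / 6) (q := 11 / 6)
        (by apply Measurable.stronglyMeasurable; fun_prop) (by norm_num) (by norm_num)
        (fun u hu => ?_) (fun u hu => ?_)
      all_goals rw [Real.norm_of_nonneg (by positivity)]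
      · rw [div_mul_eq_mul_div]
        gcongr
        linarith
      · rw [show (-(11 / 6) : ℝ) = -(5 / 6) - 1 by norm_num, Real.rpow_sub_one hu.ne',
          ← mul_div_assoc]
        gcongr
        linarith
    · refine (ae_restrict_iff' measurableSet_Ioi).2 (Eventually.of_forall fun u hu => ?_)
      exact (tendsto_r2_half hu).div_const _
  have hsin : Tendsto (fun a : ℝ => Complex.sin (Real.pi * a) / Real.pi) (𝓝[≠] (1 / 2))
      (𝓝 (Complex.sin (Real.pi * (1 / 2)) / Real.pi)) := by
    have hc : Continuous (fun a : ℝ => Complex.sin (Real.pi * a) / Real.pi) := by fun_prop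
    have := (hc.tendsto (1 / 2)).mono_left (nhdsWithin_le_nhds (s := {1 / 2}ᶜ))
    simpa using this
  refine tendsto_nhds_unique ((hsin.mul hint).congr' ?_) ((tendsto_r2_half ht).sub_const _)
  filter_upwards [self_mem_nhdsWithin, mem_nhdsWithin_of_mem_nhds
    (Ioo_mem_nhds (by norm_num : (0 : ℝ) < 1 / 2) (by norm_num : (1 / 2 : ℝ) < 1))] with a ha hI
  exact resolvent_identity_of_ne_half (by simpa using hI.1) (by simpa using hI.2)
    (fun h => ha (by simpa using congrArg Complex.re h)) ht ht1

lemma resolvent_identity {α : ℂ} (h0 : 0 < α.re) (h1 : α.re < 1) {t : ℝ} (ht : 0 < t)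
    (ht1 : t ≠ 1) :
    Complex.sin (Real.pi * α) / Real.pi * ∫ u in Ioi (0 : ℝ), r2 α u / ((t : ℂ) + u) =
      r2 α t - 1 / (1 + (t : ℂ)) := by
  by_cases hα : α = 1 / 2
  · subst hα
    exact resolvent_identity_half ht ht1
  · exact resolvent_identity_of_ne_half h0 h1 hα ht ht1

/-- The kernel `(1 / y) * p (x / y)`, homogeneous of degree `-1`, with profile `p`. -/
def scaleKernel (p : ℝ → ℂ) (x y : ℝ) : ℂ := (1 / (y : ℂ)) * p (x / y)

/-- The integral operator on `(0, ∞)` with kernel `scaleKernel p`. -/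
def kernelOp (p f : ℝ → ℂ) (x : ℝ) : ℂ := ∫ y in Ioi (0 : ℝ), scaleKernel p x y * f y

/-- The profile of the Stieltjes kernel `1 / (x + y)`. -/
def stieltjesProfile (t : ℝ) : ℂ := 1 / (1 + (t : ℂ))

lemma measurable_stieltjesProfile : Measurable stieltjesProfile := by
  unfold stieltjesProfile
  fun_prop

lemma scaleKernel_stieltjesProfile {x y : ℝ} (hx : 0 < x) (hy : 0 < y) :
    scaleKernel stieltjesProfile x y = 1 / ((x : ℂ) + y) := by
  have h := ofReal_add_ne_zero hx hy
  have hy0 : (y : ℂ) ≠ 0 := by exact_mod_cast hy.ne'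
  rw [scaleKernel, stieltjesProfile, Complex.ofReal_div, one_div_mul_one_div,
    mul_add, mul_one, mul_div_cancel₀ _ hy0, add_comm]

lemma norm_stieltjesProfile_le {k : ℝ} (h0 : 0 ≤ k) (h1 : k ≤ 1) {t : ℝ} (ht : 0 < t) :
    ‖stieltjesProfile t‖ ≤ 1 * t ^ (-k) := by
  have hn : ‖1 + (t : ℂ)‖ = 1 + t := by simpa using norm_ofReal_add one_pos ht
  rw [stieltjesProfile, norm_div, norm_one, hn, one_mul, Real.rpow_neg ht.le, ← one_div]
  refine one_div_le_one_div_of_le (by positivity) ?_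
  rcases le_total t 1 with h | h
  · linarith [Real.rpow_le_one ht.le h h0]
  · calc t ^ k ≤ t ^ (1 : ℝ) := Real.rpow_le_rpow_of_exponent_le h h1
      _ ≤ 1 + t := by rw [Real.rpow_one]; linarith

lemma norm_scaleKernel_le {p : ℝ → ℂ} {C k : ℝ} (hb : ∀ t, 0 < t → ‖p t‖ ≤ C * t ^ (-k))
    {x y : ℝ} (hx : 0 < x) (hy : 0 < y) :
    ‖scaleKernel p x y‖ ≤ C * x ^ (-k) * y ^ (k - 1) := by
  rw [scaleKernel, norm_mul, norm_div, norm_one, Complex.norm_real, Real.norm_of_nonneg hy.le]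
  calc 1 / y * ‖p (x / y)‖ ≤ 1 / y * (C * (x / y) ^ (-k)) := by gcongr; exact hb _ (by positivity)
    _ = _ := by
      rw [Real.div_rpow hx.le hy.le, Real.rpow_neg hy.le, Real.rpow_sub_one hy.ne']
      field_simp

lemma measurable_scaleKernel {p : ℝ → ℂ} (hp : Measurable p) :
    Measurable (fun z : ℝ × ℝ => scaleKernel p z.1 z.2) := by
  unfold scaleKernel
  fun_prop

lemma MemEk.aestronglyMeasurable {k : ℝ} {f : ℝ → ℂ} (hf : MemEk k f) :
    AEStronglyMeasurable f (volume.restrict (Ioi 0)) := by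
  have h : AEStronglyMeasurable (fun x : ℝ => x ^ (1 - k) • (x ^ (k - 1) • f x))
      (volume.restrict (Ioi 0)) :=
    (by fun_prop : Measurable fun x : ℝ => x ^ (1 - k)).aestronglyMeasurable.smul
      (Integrable.aestronglyMeasurable hf)
  refine h.congr ((ae_restrict_iff' measurableSet_Ioi).2 (Eventually.of_forall fun x hx => ?_))
  have hx0 : (0 : ℝ) < x := hx
  simp only
  rw [smul_smul, ← Real.rpow_add hx0, sub_add_sub_cancel, sub_self, Real.rpow_zero, one_smul]

lemma integrable_mul_of_norm_le_rpow {X : Type*} [MeasurableSpace X] {μ : Measure X}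
    {b W : X → ℂ} {w : X → ℝ} {k D : ℝ} (hbm : AEStronglyMeasurable b μ)
    (hwm : AEStronglyMeasurable w μ) (hW : Integrable (fun z => (w z ^ (k - 1) : ℝ) • W z) μ)
    (hw : ∀ᵐ z ∂μ, 0 < w z) (hb : ∀ᵐ z ∂μ, ‖b z‖ ≤ D * w z ^ (k - 1)) :
    Integrable (fun z => b z * W z) μ := by
  have hm : AEStronglyMeasurable (fun z => (w z ^ (1 - k) : ℝ) • b z) μ :=
    (hwm.aemeasurable.pow_const _).aestronglyMeasurable.smul hbm
  refine (hW.bdd_mul (c := D) hm ?_).congr ?_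
  · filter_upwards [hw, hb] with z hz hbz
    rw [norm_smul, Real.norm_of_nonneg (by positivity)]
    calc _ ≤ w z ^ (1 - k) * (D * w z ^ (k - 1)) := by gcongr
      _ = D * (w z ^ (1 - k) * w z ^ (k - 1)) := by ring
      _ = D := by
        rw [← Real.rpow_add hz, sub_add_sub_cancel, sub_self, Real.rpow_zero, mul_one]
  · filter_upwards [hw] with z hz
    rw [smul_mul_smul_comm, ← Real.rpow_add hz, sub_add_sub_cancel, sub_self, Real.rpow_zero,
      one_smul]

lemma integrableOn_scaleKernel_mul {p f : ℝ → ℂ} {C k : ℝ} (hp : Measurable p)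
    (hb : ∀ t, 0 < t → ‖p t‖ ≤ C * t ^ (-k)) (hf : MemEk k f) {x : ℝ} (hx : 0 < x) :
    IntegrableOn (fun y => scaleKernel p x y * f y) (Ioi 0) := by
  refine integrable_mul_of_norm_le_rpow (w := fun y => y) (D := C * x ^ (-k)) ?_ (by fun_prop) hf
    (ae_restrict_mem measurableSet_Ioi) ?_
  · exact ((measurable_scaleKernel hp).comp (by fun_prop : Measurable fun y : ℝ =>
      (x, y))).aestronglyMeasurable
  · filter_upwards [ae_restrict_mem measurableSet_Ioi] with y hy
    exact norm_scaleKernel_le hb hx hy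

lemma memEk_of_norm_le {p : ℝ → ℂ} {k k₁ k₂ A B : ℝ} (hp : Measurable p) (h1 : k₁ < k)
    (h2 : k < k₂) (hA : ∀ t, 0 < t → ‖p t‖ ≤ A * t ^ (-k₁))
    (hB : ∀ t, 0 < t → ‖p t‖ ≤ B * t ^ (-k₂)) : MemEk k p := by
  refine integrableOn_Ioi_of_norm_le_rpow (A := A) (B := B) (p := 1 + k₁ - k) (q := 1 + k₂ - k)
    (by apply Measurable.stronglyMeasurable; fun_prop) (by linarith) (by linarith)
    (fun t ht => ?_) (fun t ht => ?_)
  all_goals rw [norm_smul, Real.norm_of_nonneg (by positivity)]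
  · rw [show -(1 + k₁ - k) = (k - 1) + -k₁ by ring, Real.rpow_add ht, mul_left_comm]
    gcongr
    exact hA t ht
  · rw [show -(1 + k₂ - k) = (k - 1) + -k₂ by ring, Real.rpow_add ht, mul_left_comm]
    gcongr
    exact hB t ht

lemma rpow_smul_scaleKernel_mul {q : ℝ → ℂ} {k y u : ℝ} (hy : 0 < y) (hu : 0 < u) :
    (((y * u) ^ (k - 1) : ℝ)) • scaleKernel q (y * u) y =
      (y ^ (k - 1) * y⁻¹ : ℝ) • ((u ^ (k - 1) : ℝ) • q u) := by
  rw [scaleKernel, mul_div_cancel_left₀ _ hy.ne', Real.mul_rpow hy.le hu.le]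
  simp only [Complex.real_smul]
  push_cast
  ring

lemma integrableOn_rpow_smul_scaleKernel {q : ℝ → ℂ} {k : ℝ} (hqk : MemEk k q) {y : ℝ}
    (hy : 0 < y) : IntegrableOn (fun z => (z ^ (k - 1) : ℝ) • scaleKernel q z y) (Ioi 0) := by
  have h := integrableOn_Ioi_comp_mul_left_iff
    (fun z : ℝ => (z ^ (k - 1) : ℝ) • scaleKernel q z y) 0 hy
  rw [mul_zero] at h
  rw [← h]
  refine (integrableOn_congr_fun (fun u hu => ?_) measurableSet_Ioi).2
    (hqk.smul (y ^ (k - 1) * y⁻¹))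
  exact rpow_smul_scaleKernel_mul hy hu

lemma integral_norm_rpow_smul_scaleKernel {q : ℝ → ℂ} {k y : ℝ} (hy : 0 < y) :
    ∫ z in Ioi (0 : ℝ), ‖(z ^ (k - 1) : ℝ) • scaleKernel q z y‖ =
      y ^ (k - 1) * ∫ u in Ioi (0 : ℝ), ‖(u ^ (k - 1) : ℝ) • q u‖ := by
  have h := integral_comp_mul_left_Ioi'
    (fun z : ℝ => ‖(z ^ (k - 1) : ℝ) • scaleKernel q z y‖) 0 hy
  rw [mul_zero] at h
  rw [← h, smul_eq_mul, ← integral_const_mul, ← integral_const_mul]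
  refine setIntegral_congr_fun measurableSet_Ioi fun u hu => ?_
  rw [rpow_smul_scaleKernel_mul hy hu, norm_smul (y ^ (k - 1) * y⁻¹ : ℝ),
    Real.norm_of_nonneg (by positivity)]
  field_simp

lemma integrable_prod_scaleKernel {q h : ℝ → ℂ} {k : ℝ} (hq : Measurable q) (hqk : MemEk k q)
    (hh : MemEk k h) :
    Integrable (fun z : ℝ × ℝ => (z.1 ^ (k - 1) : ℝ) • (scaleKernel q z.1 z.2 * h z.2))
      ((volume.restrict (Ioi 0)).prod (volume.restrict (Ioi 0))) := by
  have hm : AEStronglyMeasurable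
      (fun z : ℝ × ℝ => (z.1 ^ (k - 1) : ℝ) • (scaleKernel q z.1 z.2 * h z.2))
      ((volume.restrict (Ioi 0)).prod (volume.restrict (Ioi 0))) :=
    (by fun_prop : Measurable fun z : ℝ × ℝ => z.1 ^ (k - 1)).aestronglyMeasurable.smul
      ((measurable_scaleKernel hq).aestronglyMeasurable.mul hh.aestronglyMeasurable.comp_snd)
  rw [integrable_prod_iff' hm]
  constructor
  · filter_upwards [ae_restrict_mem measurableSet_Ioi] with y hy
    simp only [← smul_mul_assoc]
    exact (integrableOn_rpow_smul_scaleKernel hqk hy).mul_const _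
  · refine (hh.norm.const_mul (∫ u in Ioi (0 : ℝ), ‖(u ^ (k - 1) : ℝ) • q u‖)).congr ?_
    filter_upwards [ae_restrict_mem measurableSet_Ioi] with y hy
    have hy0 : (0 : ℝ) < y := hy
    simp only [← smul_mul_assoc]
    simp only [norm_mul]
    rw [integral_mul_const, integral_norm_rpow_smul_scaleKernel hy, norm_smul (y ^ (k - 1)),
      Real.norm_of_nonneg (by positivity)]
    ring

lemma integral_scaleKernel_mul_kernelOp {p q h : ℝ → ℂ} {C k : ℝ} (hp : Measurable p)
    (hb : ∀ t, 0 < t → ‖p t‖ ≤ C * t ^ (-k)) (hq : Measurable q) (hqk : MemEk k q)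
    (hh : MemEk k h) {x : ℝ} (hx : 0 < x) :
    ∫ z in Ioi (0 : ℝ), scaleKernel p x z * kernelOp q h z =
      ∫ y in Ioi (0 : ℝ), (∫ z in Ioi (0 : ℝ), scaleKernel p x z * scaleKernel q z y) * h y := by
  have hfst : ∀ᵐ z : ℝ × ℝ ∂((volume.restrict (Ioi 0)).prod (volume.restrict (Ioi 0))),
      0 < z.1 := by
    have := Measure.quasiMeasurePreserving_fst (μ := volume.restrict (Ioi (0 : ℝ)))
      (ν := volume.restrict (Ioi (0 : ℝ)))
    exact this.ae (ae_restrict_mem measurableSet_Ioi)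
  have hint : Integrable (fun z : ℝ × ℝ => scaleKernel p x z.1 * (scaleKernel q z.1 z.2 * h z.2))
      ((volume.restrict (Ioi 0)).prod (volume.restrict (Ioi 0))) := by
    refine integrable_mul_of_norm_le_rpow (w := Prod.fst) (D := C * x ^ (-k)) ?_ (by fun_prop)
      (integrable_prod_scaleKernel hq hqk hh) hfst ?_
    · exact ((measurable_scaleKernel hp).comp (by fun_prop : Measurable fun z : ℝ × ℝ =>
        (x, z.1))).aestronglyMeasurable
    · filter_upwards [hfst] with z hz
      exact norm_scaleKernel_le hb hx hz
  simp only [kernelOp, ← integral_const_mul, ← integral_mul_const, mul_assoc]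
  exact integral_integral_swap hint

lemma integral_stieltjes_mul_scaleKernel (r : ℝ → ℂ) {x y : ℝ} (hx : 0 < x) (hy : 0 < y) :
    ∫ z in Ioi (0 : ℝ), scaleKernel stieltjesProfile x z * scaleKernel r z y =
      1 / y * ∫ u in Ioi (0 : ℝ), r u / (((x / y : ℝ) : ℂ) + u) := by
  have h := integral_comp_mul_left_Ioi'
    (fun z : ℝ => scaleKernel stieltjesProfile x z * scaleKernel r z y) 0 hy
  rw [mul_zero] at h
  rw [← h, ← integral_smul, ← integral_const_mul]
  refine setIntegral_congr_fun measurableSet_Ioi fun u hu => ?_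
  have hu0 : (0 : ℝ) < u := hu
  have hy0 : (y : ℂ) ≠ 0 := by exact_mod_cast hy.ne'
  have e1 := ofReal_add_ne_zero hx (mul_pos hy hu0)
  rw [scaleKernel_stieltjesProfile hx (by positivity), scaleKernel, mul_div_cancel_left₀ _ hy.ne',
    Complex.real_smul]
  push_cast at e1 ⊢
  field_simp

lemma integral_scaleKernel_mul_stieltjes (r : ℝ → ℂ) {x y : ℝ} (hx : 0 < x) (hy : 0 < y) :
    ∫ z in Ioi (0 : ℝ), scaleKernel r x z * scaleKernel stieltjesProfile z y =
      1 / y * ∫ u in Ioi (0 : ℝ), r u / (((x / y : ℝ) : ℂ) + u) := by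
  have h := integral_comp_mul_left_Ioi'
    (fun z : ℝ => scaleKernel r x z * scaleKernel stieltjesProfile z y) 0 hx
  rw [mul_zero] at h
  rw [← h, ← integral_smul, ← integral_Ioi_comp_inv, ← integral_const_mul]
  refine setIntegral_congr_fun measurableSet_Ioi fun u hu => ?_
  have hu0 : (0 : ℝ) < u := hu
  have hy0 : (y : ℂ) ≠ 0 := by exact_mod_cast hy.ne'
  have hx0 : (x : ℂ) ≠ 0 := by exact_mod_cast hx.ne'
  have hu1 : (u : ℂ) ≠ 0 := by exact_mod_cast hu0.ne'
  have e1 := ofReal_add_ne_zero hx (mul_pos hy hu0)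
  have e2 : x / (x * u⁻¹) = u := by field_simp
  rw [scaleKernel_stieltjesProfile (by positivity) hy, scaleKernel, e2, Complex.real_smul,
    Complex.real_smul]
  push_cast at e1 ⊢
  field_simp

lemma integral_scaleKernel_mul_of_ae_eq {p f g F : ℝ → ℂ} {C k : ℝ} {c : ℂ} (hp : Measurable p)
    (hb : ∀ t, 0 < t → ‖p t‖ ≤ C * t ^ (-k)) (hf : MemEk k f) (hg : MemEk k g)
    (hae : ∀ᵐ x ∂(volume.restrict (Ioi (0 : ℝ))), f x = g x + c * F x) {x : ℝ} (hx : 0 < x) :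
    c * ∫ z in Ioi (0 : ℝ), scaleKernel p x z * F z = kernelOp p f x - kernelOp p g x := by
  rw [kernelOp, kernelOp, ← integral_sub (integrableOn_scaleKernel_mul hp hb hf hx)
    (integrableOn_scaleKernel_mul hp hb hg hx), ← integral_const_mul]
  refine integral_congr_ae ?_
  filter_upwards [hae] with z hz
  rw [hz]
  ring

lemma const_mul_integral_scaleKernel_mul_kernelOp {p q r s h : ℝ → ℂ} {C D E k : ℝ} {c : ℂ}
    (hp : Measurable p) (hpb : ∀ t, 0 < t → ‖p t‖ ≤ C * t ^ (-k)) (hq : Measurable q)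
    (hqk : MemEk k q) (hr : Measurable r) (hrb : ∀ t, 0 < t → ‖r t‖ ≤ D * t ^ (-k))
    (hs : Measurable s) (hsb : ∀ t, 0 < t → ‖s t‖ ≤ E * t ^ (-k)) (hh : MemEk k h) {x : ℝ}
    (hx : 0 < x)
    (hcomp : ∀ y, 0 < y → y ≠ x → c * ∫ z in Ioi (0 : ℝ), scaleKernel p x z * scaleKernel q z y =
      scaleKernel r x y - scaleKernel s x y) :
    c * ∫ z in Ioi (0 : ℝ), scaleKernel p x z * kernelOp q h z =
      kernelOp r h x - kernelOp s h x := by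
  rw [integral_scaleKernel_mul_kernelOp hp hpb hq hqk hh hx, kernelOp, kernelOp,
    ← integral_sub (integrableOn_scaleKernel_mul hr hrb hh hx)
    (integrableOn_scaleKernel_mul hs hsb hh hx), ← integral_const_mul]
  refine integral_congr_ae ?_
  filter_upwards [ae_restrict_mem measurableSet_Ioi, ae_restrict_of_ae (Measure.ae_ne volume x)]
    with y hy hyx
  rw [← mul_assoc, hcomp y hy hyx, sub_mul]

lemma resolvent_kernel_identity {α : ℂ} (h0 : 0 < α.re) (h1 : α.re < 1) {x y : ℝ} (hx : 0 < x)
    (hy : 0 < y) (hyx : y ≠ x) :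
    Complex.sin (Real.pi * α) / Real.pi *
        (1 / y * ∫ u in Ioi (0 : ℝ), r2 α u / (((x / y : ℝ) : ℂ) + u)) =
      scaleKernel (r2 α) x y - scaleKernel stieltjesProfile x y := by
  have ht1 : x / y ≠ 1 := fun h => hyx ((div_eq_one_iff_eq hy.ne').1 h).symm
  rw [mul_left_comm, resolvent_identity h0 h1 (div_pos hx hy) ht1, scaleKernel, scaleKernel,
    stieltjesProfile, mul_sub]

/-- Proposition 1, kernel `R₂`: for `0 < Re α ≤ 1/2`,
`1 - Re α < k < 1`, `λ = sin(πα)/π` and `g ∈ E_k`, a function `f ∈ E_k`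
satisfies the Stieltjes equation a.e. iff `f = g + λ R₂ g` a.e. -/
theorem stmt7 (α : ℂ) (hα1 : 0 < α.re) (hα2 : α.re ≤ 1/2)
    (k : ℝ) (hk1 : 1 - α.re < k) (hk2 : k < 1)
    (lam : ℂ) (hlam : lam = Complex.sin ((Real.pi : ℂ) * α) / (Real.pi : ℂ))
    (g : ℝ → ℂ) (hg : MemEk k g) (f : ℝ → ℂ) (hf : MemEk k f) :
    ((∀ x : ℝ, 0 < x → IntegrableOn (fun y : ℝ => f y / ((x : ℂ) + (y : ℂ))) (Ioi 0)) ∧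
      (∀ᵐ x ∂(volume.restrict (Ioi (0 : ℝ))),
        f x = g x + lam * ∫ y in Ioi (0 : ℝ), f y / ((x : ℂ) + (y : ℂ))))
    ↔
    ((∀ x : ℝ, 0 < x → IntegrableOn (fun y : ℝ => R2 α x y * g y) (Ioi 0)) ∧
      (∀ᵐ x ∂(volume.restrict (Ioi (0 : ℝ))),
        f x = g x + lam * ∫ y in Ioi (0 : ℝ), R2 α x y * g y)) := by
  have hα3 : α.re < 1 := by linarith
  obtain ⟨C, hC⟩ := exists_norm_r2_le hα1 hα2 hk1 (by linarith)
  obtain ⟨A, hA⟩ := exists_norm_r2_le hα1 hα2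
    (by linarith : 1 - α.re < (1 - α.re + k) / 2) (by linarith)
  obtain ⟨B, hB⟩ := exists_norm_r2_le hα1 hα2 (by linarith : 1 - α.re < 2) le_rfl
  have hrm := measurable_r2 α
  have hsm := measurable_stieltjesProfile
  have hk0 : 0 ≤ k := by linarith
  have hrk : MemEk k (r2 α) :=
    memEk_of_norm_le hrm (by linarith) (by linarith) hA hB
  have hsb : ∀ t, 0 < t → ‖stieltjesProfile t‖ ≤ 1 * t ^ (-k) :=
    fun t ht => norm_stieltjesProfile_le hk0 hk2.le ht
  have hsk : MemEk k stieltjesProfile :=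
    memEk_of_norm_le hsm (by linarith : (0 : ℝ) < k) hk2
      (fun t ht => norm_stieltjesProfile_le le_rfl zero_le_one ht)
      (fun t ht => norm_stieltjesProfile_le zero_le_one le_rfl ht)
  have hstieltjes : ∀ h : ℝ → ℂ, ∀ x : ℝ, 0 < x → EqOn
      (fun y : ℝ => h y / ((x : ℂ) + (y : ℂ))) (fun y => scaleKernel stieltjesProfile x y * h y)
      (Ioi 0) := fun h x hx y hy => by
    simp only [scaleKernel_stieltjesProfile hx hy, one_div_mul_eq_div]
  have hop : ∀ x : ℝ, 0 < x → ∫ y in Ioi (0 : ℝ), f y / ((x : ℂ) + (y : ℂ)) =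
      kernelOp stieltjesProfile f x :=
    fun x hx => setIntegral_congr_fun measurableSet_Ioi (hstieltjes f x hx)
  have hi1 : ∀ x : ℝ, 0 < x → IntegrableOn (fun y : ℝ => f y / ((x : ℂ) + (y : ℂ))) (Ioi 0) :=
    fun x hx => (integrableOn_congr_fun (hstieltjes f x hx) measurableSet_Ioi).2
      (integrableOn_scaleKernel_mul hsm hsb hf hx)
  have hi2 : ∀ x : ℝ, 0 < x → IntegrableOn (fun y : ℝ => R2 α x y * g y) (Ioi 0) :=
    fun x hx => integrableOn_scaleKernel_mul hrm hC hg hx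
  constructor
  · rintro ⟨-, hae⟩
    have hae' : ∀ᵐ x ∂(volume.restrict (Ioi (0 : ℝ))),
        f x = g x + lam * kernelOp stieltjesProfile f x := by
      filter_upwards [hae, ae_restrict_mem measurableSet_Ioi] with x hx hx0
      rw [hx, hop x hx0]
    refine ⟨hi2, ?_⟩
    filter_upwards [hae', ae_restrict_mem measurableSet_Ioi] with x hx hx0
    have e1 := integral_scaleKernel_mul_of_ae_eq hrm hC hf hg hae' hx0
    have e2 := const_mul_integral_scaleKernel_mul_kernelOp (c := lam) hrm hC hsm hsk hrm hC hsm hsb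
      hf hx0 fun y hy hyx => by
        rw [integral_scaleKernel_mul_stieltjes (r2 α) hx0 hy, hlam,
          resolvent_kernel_identity hα1 hα3 hx0 hy hyx]
    have e3 : kernelOp stieltjesProfile f x = kernelOp (r2 α) g x :=
      (sub_right_inj.1 (e1.symm.trans e2)).symm
    rw [hx, e3]
    rfl
  · rintro ⟨-, hae⟩
    refine ⟨hi1, ?_⟩
    filter_upwards [hae, ae_restrict_mem measurableSet_Ioi] with x hx hx0
    have e1 := integral_scaleKernel_mul_of_ae_eq (F := kernelOp (r2 α) g) hsm hsb hf hg hae hx0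
    have e2 := const_mul_integral_scaleKernel_mul_kernelOp (c := lam) hsm hsb hrm hrk hrm hC hsm hsb
      hg hx0 fun y hy hyx => by
        rw [integral_stieltjes_mul_scaleKernel (r2 α) hx0 hy, hlam,
          resolvent_kernel_identity hα1 hα3 hx0 hy hyx]
    have e3 : kernelOp stieltjesProfile f x = kernelOp (r2 α) g x :=
      sub_left_inj.1 (e1.symm.trans e2)
    rw [hop x hx0, e3]
    exact hx

end
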